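/- There exists a constant C > 0 with the following property. Let h : [-1,1] × [-1,0] → ℝ be a nonnegative solution of the heat equation on the rectangle [-1,1] × [-1,0]. Then for every μ ∈ (0,1), the second spatial derivative of h at the origin satisfies |∂²_x h(0,0)| ≤ C μ^{-2} h(0,0) + C e^{-1/(8μ)} · sup { h(x,t) : x ∈ {-1,1}, t ∈ [-1,0] }. -/

import Mathlib

open Real Set

/-- `h : ℝ → ℝ → ℝ` (first argument space, second argument time) is a solution of the
heat equation on the rectangle `[-1,1] × [-1,0]`: it is continuous on the closed rectangle,
smooth on `(-1,1) × (-1,0]`, and satisfies `∂_t h = ∂²_x h` there (the time derivative at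
`t = 0` being the one-sided derivative within `(-∞,0]`). -/
def IsHeatSolution (h : ℝ → ℝ → ℝ) : Prop :=
  ContinuousOn (fun p : ℝ × ℝ => h p.1 p.2) (Set.Icc (-1) 1 ×ˢ Set.Icc (-1) 0) ∧
  ContDiffOn ℝ (⊤ : ℕ∞) (fun p : ℝ × ℝ => h p.1 p.2) (Set.Ioo (-1) 1 ×ˢ Set.Ioc (-1) 0) ∧
  ∀ x ∈ Set.Ioo (-1 : ℝ) 1, ∀ t ∈ Set.Ioc (-1 : ℝ) 0,
    derivWithin (fun s => h x s) (Set.Iic 0) t = deriv (deriv (fun y => h y t)) x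


lemma heat_slice {h : ℝ → ℝ → ℝ} (H : IsHeatSolution h) {t : ℝ} (ht : t ∈ Ioc (-1 : ℝ) 0) :
    ContDiffOn ℝ (⊤ : ℕ∞) (fun y => h y t) (Ioo (-1) 1) := by
  have h2 := H.2.1
  have : ContDiffOn ℝ (⊤ : ℕ∞) (fun y : ℝ => (y, t)) (Ioo (-1) 1) := by fun_prop
  exact h2.comp this (fun y hy => ⟨hy, ht⟩)

lemma slice_facts {f : ℝ → ℝ} (H : ContDiffOn ℝ (⊤ : ℕ∞) f (Ioo (-1) 1)) :
    (∀ x ∈ Ioo (-1 : ℝ) 1, HasDerivAt f (deriv f x) x) ∧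
    (∀ x ∈ Ioo (-1 : ℝ) 1, HasDerivAt (deriv f) (deriv (deriv f) x) x) ∧
    ContinuousOn (deriv (deriv f)) (Ioo (-1) 1) := by
  have hd : ContDiffOn ℝ (⊤ : ℕ∞) (deriv f) (Ioo (-1) 1) :=
    H.deriv_of_isOpen isOpen_Ioo (by simp)
  have hdd : ContDiffOn ℝ (⊤ : ℕ∞) (deriv (deriv f)) (Ioo (-1) 1) :=
    hd.deriv_of_isOpen isOpen_Ioo (by simp)
  refine ⟨fun x hx => ?_, fun x hx => ?_, hdd.continuousOn⟩
  · exact ((H.differentiableOn (by simp)).differentiableAt (isOpen_Ioo.mem_nhds hx)).hasDerivAt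
  · exact ((hd.differentiableOn (by simp)).differentiableAt (isOpen_Ioo.mem_nhds hx)).hasDerivAt

lemma time_facts {h : ℝ → ℝ → ℝ} (H : IsHeatSolution h) :
    ∃ ht : ℝ → ℝ → ℝ, ContinuousOn (fun p : ℝ × ℝ => ht p.1 p.2) (Ioo (-1) 1 ×ˢ Ioo (-1) 0) ∧
      ∀ x ∈ Ioo (-1 : ℝ) 1, ∀ t ∈ Ioo (-1 : ℝ) 0,
        HasDerivAt (fun s => h x s) (ht x t) t ∧ ht x t = deriv (deriv (fun y => h y t)) x := by
  set F : ℝ × ℝ → ℝ := fun p => h p.1 p.2 with hF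
  have hU : IsOpen (Ioo (-1 : ℝ) 1 ×ˢ Ioo (-1 : ℝ) 0) := isOpen_Ioo.prod isOpen_Ioo
  have hc : ContDiffOn ℝ (⊤ : ℕ∞) F (Ioo (-1) 1 ×ˢ Ioo (-1) 0) :=
    H.2.1.mono (Set.prod_mono le_rfl Ioo_subset_Ioc_self)
  have hfd := (hc.fderiv_of_isOpen (m := (⊤ : ℕ∞)) hU (by simp)).continuousOn
  refine ⟨fun x t => fderiv ℝ F (x, t) (0, 1), ?_, ?_⟩
  · exact hfd.clm_apply continuousOn_const
  · intro x hx t ht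
    have hd : HasFDerivAt F (fderiv ℝ F (x, t)) (x, t) :=
      ((hc.differentiableOn (by simp)).differentiableAt (hU.mem_nhds ⟨hx, ht⟩)).hasFDerivAt
    have hl : HasDerivAt (fun s : ℝ => (x, s)) ((0 : ℝ), (1 : ℝ)) t :=
      (hasDerivAt_const t x).prodMk (hasDerivAt_id t)
    have h1 : HasDerivAt (fun s => h x s) (fderiv ℝ F (x, t) (0, 1)) t :=
      hd.comp_hasDerivAt t hl
    refine ⟨h1, ?_⟩
    rw [← H.2.2 x hx t ⟨ht.1, ht.2.le⟩]
    exact (h1.hasDerivWithinAt.derivWithin (uniqueDiffOn_Iic 0 t ht.2.le)).symm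

lemma param_cont {f : ℝ → ℝ → ℝ} {r a b : ℝ} (hr : 0 ≤ r) (hab : a ≤ b)
    (hf : ContinuousOn (fun p : ℝ × ℝ => f p.1 p.2) (Icc (-r) r ×ˢ Icc a b)) :
    ContinuousOn (fun t => ∫ x in (-r)..r, f x t) (Icc a b) := by
  have hrr : -r ≤ r := by linarith
  set g : ℝ → ℝ → ℝ := fun t x => f (projIcc (-r) r hrr x) (projIcc a b hab t) with hg
  have hgc : Continuous g.uncurry := by
    have : Continuous (fun p : ℝ × ℝ =>
        (((projIcc (-r) r hrr p.2 : ℝ), (projIcc a b hab p.1 : ℝ)) : ℝ × ℝ)) := by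
      refine Continuous.prodMk ?_ ?_
      · exact continuous_subtype_val.comp (continuous_projIcc.comp continuous_snd)
      · exact continuous_subtype_val.comp (continuous_projIcc.comp continuous_fst)
    exact hf.comp_continuous this (fun p => ⟨Subtype.coe_prop _, Subtype.coe_prop _⟩)
  have := intervalIntegral.continuous_parametric_intervalIntegral_of_continuous'
    (μ := MeasureTheory.volume) hgc (-r) r
  refine this.continuousOn.congr ?_
  intro t ht
  refine intervalIntegral.integral_congr ?_
  intro x hx
  rw [uIcc_of_le hrr] at hx
  simp only [hg, projIcc_of_mem hrr hx, projIcc_of_mem hab ht]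

structure TestFn (r a b : ℝ) (φ φx φxx φt : ℝ → ℝ → ℝ) : Prop where
  dx : ∀ t ∈ Ioo a b, ∀ x, HasDerivAt (fun y => φ y t) (φx x t) x
  dxx : ∀ t ∈ Ioo a b, ∀ x, HasDerivAt (fun y => φx y t) (φxx x t) x
  dt : ∀ t ∈ Ioo a b, ∀ x, HasDerivAt (fun s => φ x s) (φt x t) t
  c : ContinuousOn (fun p : ℝ × ℝ => φ p.1 p.2) (univ ×ˢ Icc a b)
  cxx : ContinuousOn (fun p : ℝ × ℝ => φxx p.1 p.2) (univ ×ˢ Icc a b)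
  ct : ContinuousOn (fun p : ℝ × ℝ => φt p.1 p.2) (univ ×ˢ Icc a b)
  z : ∀ t ∈ Ioo a b, φ r t = 0 ∧ φ (-r) t = 0

lemma slice_cont {f : ℝ → ℝ → ℝ} {A B : Set ℝ}
    (hf : ContinuousOn (fun p : ℝ × ℝ => f p.1 p.2) (A ×ˢ B)) {t : ℝ} (ht : t ∈ B) :
    ContinuousOn (fun x => f x t) A := by
  have : ContinuousOn (fun y : ℝ => (y, t)) A := by fun_prop
  exact hf.comp this (fun y hy => ⟨hy, ht⟩)

lemma key_deriv {h : ℝ → ℝ → ℝ} (H : IsHeatSolution h) {r a b : ℝ} (hr : 0 < r) (hr1 : r < 1)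
    (ha : -1 < a) (hb : b ≤ 0) {φ φx φxx φt : ℝ → ℝ → ℝ} (T : TestFn r a b φ φx φxx φt)
    {t : ℝ} (ht : t ∈ Ioo a b) :
    HasDerivAt (fun s => ∫ x in (-r)..r, h x s * φ x s)
      ((∫ x in (-r)..r, h x t * (φt x t + φxx x t)) - h r t * φx r t + h (-r) t * φx (-r) t) t := by
  obtain ⟨hT, hTc, hTd⟩ := time_facts H
  have hrr : -r ≤ r := by linarith
  have hsub : Icc (-r) r ⊆ Ioo (-1) 1 := fun x hx => ⟨by linarith [hx.1], by linarith [hx.2]⟩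
  have hsubt : Ioo a b ⊆ Ioo (-1) 0 := fun x hx => ⟨by linarith [hx.1], by linarith [hx.2]⟩
  have hhc : ContinuousOn (fun p : ℝ × ℝ => h p.1 p.2) (Icc (-r) r ×ˢ Ioo a b) :=
    H.1.mono (Set.prod_mono (hsub.trans Ioo_subset_Icc_self) (hsubt.trans Ioo_subset_Icc_self))
  have hφc : ContinuousOn (fun p : ℝ × ℝ => φ p.1 p.2) (Icc (-r) r ×ˢ Ioo a b) :=
    T.c.mono (Set.prod_mono (subset_univ _) Ioo_subset_Icc_self)
  have hφtc : ContinuousOn (fun p : ℝ × ℝ => φt p.1 p.2) (Icc (-r) r ×ˢ Ioo a b) :=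
    T.ct.mono (Set.prod_mono (subset_univ _) Ioo_subset_Icc_self)
  have hφxxc : ContinuousOn (fun p : ℝ × ℝ => φxx p.1 p.2) (Icc (-r) r ×ˢ Ioo a b) :=
    T.cxx.mono (Set.prod_mono (subset_univ _) Ioo_subset_Icc_self)
  have hTc' : ContinuousOn (fun p : ℝ × ℝ => hT p.1 p.2) (Icc (-r) r ×ˢ Ioo a b) :=
    hTc.mono (Set.prod_mono hsub hsubt)
  have hF'c : ContinuousOn (fun p : ℝ × ℝ => hT p.1 p.2 * φ p.1 p.2 + h p.1 p.2 * φt p.1 p.2)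
      (Icc (-r) r ×ˢ Ioo a b) := (hTc'.mul hφc).add (hhc.mul hφtc)
  obtain ⟨ε, hε, hball⟩ : ∃ ε > 0, Icc (t - ε) (t + ε) ⊆ Ioo a b := by
    refine ⟨min (t - a) (b - t) / 2, ?_, ?_⟩
    · have := ht.1; have := ht.2; have : 0 < min (t - a) (b - t) := lt_min (by linarith) (by linarith)
      linarith
    · intro s hs
      have h1 := min_le_left (t - a) (b - t)
      have h2 := min_le_right (t - a) (b - t)
      have := ht.1; have := ht.2; have : 0 < min (t - a) (b - t) := lt_min (by linarith) (by linarith)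
      exact ⟨by linarith [hs.1], by linarith [hs.2]⟩
  obtain ⟨B, hB⟩ := (isCompact_Icc.prod isCompact_Icc).exists_bound_of_continuousOn
    (hF'c.mono (Set.prod_mono (le_refl (Icc (-r) r)) hball))
  have hfix : ∀ s ∈ Ioo a b, ContinuousOn (fun x => h x s * φ x s) (Icc (-r) r) := fun s hs =>
    slice_cont (f := fun x s => h x s * φ x s) (hhc.mul hφc) hs
  have main := intervalIntegral.hasDerivAt_integral_of_dominated_loc_of_deriv_le
    (μ := MeasureTheory.volume) (a := -r) (b := r) (x₀ := t) (s := Icc (t - ε) (t + ε))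
    (F := fun s x => h x s * φ x s) (F' := fun s x => hT x s * φ x s + h x s * φt x s)
    (bound := fun _ => B) (Icc_mem_nhds (by linarith) (by linarith))
    (by
      filter_upwards [Ioo_mem_nhds ht.1 ht.2] with s hs
      rw [uIoc_of_le hrr]
      exact ((hfix s hs).mono Ioc_subset_Icc_self).aestronglyMeasurable measurableSet_Ioc)
    (by
      apply ContinuousOn.intervalIntegrable
      rw [uIcc_of_le hrr]; exact hfix t ht)
    (by
      rw [uIoc_of_le hrr]
      exact ((slice_cont (f := fun x s => hT x s * φ x s + h x s * φt x s) hF'c ht).mono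
        Ioc_subset_Icc_self).aestronglyMeasurable measurableSet_Ioc)
    (by
      refine Filter.Eventually.of_forall fun x hx s hs => ?_
      rw [uIoc_of_le hrr] at hx
      exact hB (x, s) ⟨Ioc_subset_Icc_self hx, hs⟩)
    (by simp)
    (by
      refine Filter.Eventually.of_forall fun x hx s hs => ?_
      rw [uIoc_of_le hrr] at hx
      exact (hTd x (hsub (Ioc_subset_Icc_self hx)) s (hsubt (hball hs))).1.mul
        (T.dt s (hball hs) x))
  have ht0 := hsubt ht
  obtain ⟨s1, s2, s3⟩ := slice_facts (heat_slice H ⟨ht0.1, ht0.2.le⟩)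
  have hparts : ∫ x in (-r)..r, (deriv (deriv (fun y => h y t)) x * φ x t - h x t * φxx x t) =
      (deriv (fun y => h y t) r * φ r t - h r t * φx r t) -
      (deriv (fun y => h y t) (-r) * φ (-r) t - h (-r) t * φx (-r) t) := by
    refine intervalIntegral.integral_eq_sub_of_hasDerivAt
      (f := fun x => deriv (fun y => h y t) x * φ x t - h x t * φx x t) ?_ ?_
    · intro x hx
      rw [uIcc_of_le hrr] at hx
      have := ((s2 x (hsub hx)).mul (T.dx t ht x)).sub ((s1 x (hsub hx)).mul (T.dxx t ht x))
      refine this.congr_deriv ?_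
      ring
    · apply ContinuousOn.intervalIntegrable
      rw [uIcc_of_le hrr]
      exact ((s3.mono hsub).mul (slice_cont hφc ht)).sub ((slice_cont hhc ht).mul (slice_cont hφxxc ht))
  refine main.2.congr_deriv ?_
  have i1 : IntervalIntegrable (fun x => h x t * (φt x t + φxx x t)) MeasureTheory.volume (-r) r := by
    apply ContinuousOn.intervalIntegrable
    rw [uIcc_of_le hrr]
    exact (slice_cont hhc ht).mul ((slice_cont hφtc ht).add (slice_cont hφxxc ht))
  have i2 : IntervalIntegrable (fun x => deriv (deriv (fun y => h y t)) x * φ x t - h x t * φxx x t)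
      MeasureTheory.volume (-r) r := by
    apply ContinuousOn.intervalIntegrable
    rw [uIcc_of_le hrr]
    exact ((s3.mono hsub).mul (slice_cont hφc ht)).sub ((slice_cont hhc ht).mul (slice_cont hφxxc ht))
  have : ∫ x in (-r)..r, (hT x t * φ x t + h x t * φt x t) =
      (∫ x in (-r)..r, h x t * (φt x t + φxx x t)) +
      ∫ x in (-r)..r, (deriv (deriv (fun y => h y t)) x * φ x t - h x t * φxx x t) := by
    rw [← intervalIntegral.integral_add i1 i2]
    refine intervalIntegral.integral_congr ?_
    intro x hx
    rw [uIcc_of_le hrr] at hx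
    simp only
    rw [(hTd x (hsub hx) t ht0).2]
    ring
  rw [this, hparts, (T.z t ht).1, (T.z t ht).2]
  ring

lemma key_ineq {h : ℝ → ℝ → ℝ} (H : IsHeatSolution h) {r a b C : ℝ} (hr : 0 < r) (hr1 : r < 1)
    (ha : -1 < a) (hab : a < b) (hb : b ≤ 0) {φ φx φxx φt : ℝ → ℝ → ℝ}
    (T : TestFn r a b φ φx φxx φt)
    (hC : ∀ t ∈ Ioo a b, (∫ x in (-r)..r, h x t * (φt x t + φxx x t)) - h r t * φx r t
      + h (-r) t * φx (-r) t ≤ C) :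
    (∫ x in (-r)..r, h x b * φ x b) - (∫ x in (-r)..r, h x a * φ x a) ≤ C * (b - a) := by
  have hcont : ContinuousOn (fun s => ∫ x in (-r)..r, h x s * φ x s) (Icc a b) := by
    apply param_cont (f := fun x s => h x s * φ x s) hr.le hab.le
    refine ContinuousOn.mul (H.1.mono ?_) (T.c.mono ?_)
    · exact Set.prod_mono (Icc_subset_Icc (by linarith) hr1.le) (Icc_subset_Icc ha.le hb)
    · exact Set.prod_mono (subset_univ _) le_rfl
  obtain ⟨c, hc, he⟩ := exists_hasDerivAt_eq_slope _ _ hab hcont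
    (fun t ht => key_deriv H hr hr1 ha hb T ht)
  have := hC c hc
  rw [he, div_le_iff₀ (by linarith)] at this
  exact this

noncomputable def K0 (x u : ℝ) : ℝ := √u * exp (-(x ^ 2 / 4) * u)
noncomputable def K1 (x u : ℝ) : ℝ := -(x / 2) * u * K0 x u
noncomputable def K2 (x u : ℝ) : ℝ := (x ^ 2 / 4 * u ^ 2 - u / 2) * K0 x u
noncomputable def K3 (x u : ℝ) : ℝ := (-(x ^ 3 / 8) * u ^ 3 + 3 / 4 * x * u ^ 2) * K0 x u
noncomputable def K4 (x u : ℝ) : ℝ :=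
  (x ^ 4 / 16 * u ^ 4 - 3 / 4 * x ^ 2 * u ^ 3 + 3 / 4 * u ^ 2) * K0 x u

lemma K0_nonneg (x u : ℝ) : 0 ≤ K0 x u := by unfold K0; positivity

lemma K0_dx (u x : ℝ) : HasDerivAt (fun y => K0 y u) (K1 x u) x := by
  unfold K1 K0
  have h1 : HasDerivAt (fun y : ℝ => -(y ^ 2 / 4) * u) (-(x / 2) * u) x := by
    have := (((hasDerivAt_pow 2 x).div_const 4).neg).mul_const u
    refine this.congr_deriv ?_
    norm_num; left; ring
  refine (h1.exp.const_mul (√u)).congr_deriv ?_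
  ring

lemma K1_dx (u x : ℝ) : HasDerivAt (fun y => K1 y u) (K2 x u) x := by
  have h1 : HasDerivAt (fun y : ℝ => -(y / 2) * u) (-(1 / 2) * u) x :=
    (((hasDerivAt_id x).div_const 2).neg).mul_const u
  refine (h1.mul (K0_dx u x)).congr_deriv ?_
  simp only [K1, K2]; ring

lemma K2_dx (u x : ℝ) : HasDerivAt (fun y => K2 y u) (K3 x u) x := by
  have h1 : HasDerivAt (fun y : ℝ => y ^ 2 / 4 * u ^ 2 - u / 2) (x / 2 * u ^ 2) x := by
    refine ((((hasDerivAt_pow 2 x).div_const 4).mul_const (u ^ 2)).sub_const (u / 2)).congr_deriv ?_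
    norm_num; left; ring
  refine (h1.mul (K0_dx u x)).congr_deriv ?_
  simp only [K1, K3]; ring

lemma K3_dx (u x : ℝ) : HasDerivAt (fun y => K3 y u) (K4 x u) x := by
  have h1 : HasDerivAt (fun y : ℝ => -(y ^ 3 / 8) * u ^ 3 + 3 / 4 * y * u ^ 2)
      (-(3 * x ^ 2 / 8) * u ^ 3 + 3 / 4 * u ^ 2) x := by
    refine (((((hasDerivAt_pow 3 x).div_const 8).neg).mul_const (u ^ 3)).add
      (((hasDerivAt_id x).const_mul (3 / 4)).mul_const (u ^ 2))).congr_deriv ?_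
    norm_num
  refine (h1.mul (K0_dx u x)).congr_deriv ?_
  simp only [K1, K4]; ring

lemma K0_ds {s : ℝ} (hs : 0 < s) (x : ℝ) :
    HasDerivAt (fun s => K0 x s⁻¹) (K2 x s⁻¹) s := by
  have hi := hasDerivAt_inv hs.ne'
  have h1 := hi.sqrt (inv_ne_zero hs.ne')
  have h2 := (hi.const_mul (-(x ^ 2 / 4))).exp
  refine (h1.mul h2).congr_deriv ?_
  simp only [K2, K0]
  have hq : √s⁻¹ * √s⁻¹ = s⁻¹ := Real.mul_self_sqrt (by positivity)
  have hp : 0 < √s⁻¹ := Real.sqrt_pos.2 (by positivity)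
  have e1 : -(s ^ 2)⁻¹ / (2 * √s⁻¹) = -s⁻¹ / 2 * √s⁻¹ := by
    rw [div_eq_iff (by positivity)]
    have : -s⁻¹ / 2 * √s⁻¹ * (2 * √s⁻¹) = -s⁻¹ * (√s⁻¹ * √s⁻¹) := by ring
    rw [this, hq]; ring
  rw [e1]; ring

lemma K2_ds {s : ℝ} (hs : 0 < s) (x : ℝ) :
    HasDerivAt (fun s => K2 x s⁻¹) (K4 x s⁻¹) s := by
  have hi := hasDerivAt_inv hs.ne'
  have h1 : HasDerivAt (fun s : ℝ => x ^ 2 / 4 * s⁻¹ ^ 2 - s⁻¹ / 2)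
      (-(x ^ 2 / 2) * s⁻¹ ^ 3 + s⁻¹ ^ 2 / 2) s := by
    refine (((hi.pow 2).const_mul (x ^ 2 / 4)).sub (hi.div_const 2)).congr_deriv ?_
    norm_num; ring
  refine (h1.mul (K0_ds hs x)).congr_deriv ?_
  simp only [K2, K4]; ring

lemma K0_c : Continuous (fun p : ℝ × ℝ => K0 p.1 p.2) := by unfold K0; fun_prop
lemma K1_c : Continuous (fun p : ℝ × ℝ => K1 p.1 p.2) := by
  have := K0_c; unfold K1; fun_prop
lemma K2_c : Continuous (fun p : ℝ × ℝ => K2 p.1 p.2) := by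
  have := K0_c; unfold K2; fun_prop
lemma K3_c : Continuous (fun p : ℝ × ℝ => K3 p.1 p.2) := by
  have := K0_c; unfold K3; fun_prop
lemma K4_c : Continuous (fun p : ℝ × ℝ => K4 p.1 p.2) := by
  have := K0_c; unfold K4; fun_prop

lemma K2_le {x u : ℝ} (hx : |x| ≤ 1) (hu : 1 ≤ u) : |K2 x u| ≤ u ^ 2 * K0 x u := by
  unfold K2
  rw [abs_mul, abs_of_nonneg (K0_nonneg x u)]
  refine mul_le_mul_of_nonneg_right ?_ (K0_nonneg x u)
  have h1 : x ^ 2 ≤ 1 := by rw [← sq_abs]; exact pow_le_one₀ (abs_nonneg _) hx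
  have h2 : 0 ≤ x ^ 2 := sq_nonneg x
  have h3 : x ^ 2 * u ^ 2 ≤ u ^ 2 := by nlinarith [sq_nonneg u]
  have h4 : 0 ≤ x ^ 2 * u ^ 2 := by positivity
  rw [abs_le]; constructor <;> nlinarith

lemma K3_le {x u : ℝ} (hx : |x| ≤ 1) (hu : 1 ≤ u) : |K3 x u| ≤ u ^ 3 * K0 x u := by
  unfold K3
  rw [abs_mul, abs_of_nonneg (K0_nonneg x u)]
  refine mul_le_mul_of_nonneg_right ?_ (K0_nonneg x u)
  have hu0 : (0 : ℝ) ≤ u := by linarith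
  have h2 : |-(x ^ 3 / 8) * u ^ 3| ≤ u ^ 3 / 8 := by
    rw [abs_mul, abs_neg, abs_div, abs_pow, abs_of_nonneg (pow_nonneg hu0 3)]
    have : |x| ^ 3 ≤ 1 := pow_le_one₀ (abs_nonneg _) hx
    have h8 : |(8 : ℝ)| = 8 := by norm_num
    rw [h8]
    nlinarith [pow_nonneg hu0 3]
  have h3 : |3 / 4 * x * u ^ 2| ≤ 3 / 4 * u ^ 2 := by
    rw [abs_mul, abs_mul, abs_of_nonneg (pow_nonneg hu0 2)]
    have h8 : |(3 / 4 : ℝ)| = 3 / 4 := by norm_num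
    rw [h8]
    nlinarith [pow_nonneg hu0 2]
  have h4 : u ^ 2 ≤ u ^ 3 := by nlinarith [sq_nonneg u]
  have := abs_add_le (-(x ^ 3 / 8) * u ^ 3) (3 / 4 * x * u ^ 2)
  nlinarith [pow_nonneg hu0 3]

lemma K0_decay {x u : ℝ} (hx : 3 / 5 ≤ x ^ 2) (hu : 1 ≤ u) :
    u ^ 3 * K0 x u ≤ 24 / (3 / 320) ^ 4 * exp (-(9 / 64 * u)) := by
  have hu0 : (0 : ℝ) ≤ u := by linarith
  have h1 : √u ≤ u := by
    rw [Real.sqrt_le_left hu0]; nlinarith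
  have h2 : (3 / 320 * u) ^ 4 / (Nat.factorial 4 : ℝ) ≤ exp (3 / 320 * u) :=
    Real.pow_div_factorial_le_exp _ (by positivity) 4
  have h3 : exp (-(x ^ 2 / 4) * u) ≤ exp (-(3 / 320 * u)) * exp (-(9 / 64 * u)) := by
    rw [← Real.exp_add]; apply Real.exp_le_exp.2; nlinarith
  have h4 : u ^ 4 ≤ 24 / (3 / 320) ^ 4 * exp (3 / 320 * u) := by
    have : (Nat.factorial 4 : ℝ) = 24 := by norm_num [Nat.factorial]
    rw [this] at h2
    have e : u ^ 4 = 24 / (3 / 320) ^ 4 * ((3 / 320 * u) ^ 4 / 24) := by ring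
    rw [e]
    exact mul_le_mul_of_nonneg_left h2 (by positivity)
  have h5 : exp (3 / 320 * u) * exp (-(3 / 320 * u)) = 1 := by rw [← Real.exp_add]; simp
  unfold K0
  calc u ^ 3 * (√u * exp (-(x ^ 2 / 4) * u))
      ≤ u ^ 3 * (u * (exp (-(3 / 320 * u)) * exp (-(9 / 64 * u)))) := by gcongr
    _ = u ^ 4 * (exp (-(3 / 320 * u)) * exp (-(9 / 64 * u))) := by ring
    _ ≤ (24 / (3 / 320) ^ 4 * exp (3 / 320 * u)) * (exp (-(3 / 320 * u)) * exp (-(9 / 64 * u))) := by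
        gcongr
    _ = 24 / (3 / 320) ^ 4 * (exp (3 / 320 * u) * exp (-(3 / 320 * u))) * exp (-(9 / 64 * u)) := by ring
    _ = _ := by rw [h5, mul_one]

lemma delta_lim {g : ℝ → ℝ} {r : ℝ} (hr : 0 < r) (hg : ContinuousOn g (Icc (-r) r)) :
    Filter.Tendsto (fun δ : ℝ => ∫ x in (-r)..r, g x * K0 x δ⁻¹) (nhdsWithin 0 (Ioi 0))
      (nhds (√(π / (1 / 4)) * g 0)) := by
  have hrr : -r ≤ r := by linarith
  set c0 : ℝ := √(π / (1 / 4)) with hc0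
  have hc0p : 0 < c0 := Real.sqrt_pos.2 (by positivity)
  have hg1 : MeasureTheory.Integrable ((Icc (-r) r).indicator g) := by
    rw [MeasureTheory.integrable_indicator_iff measurableSet_Icc]
    exact hg.integrableOn_Icc
  have hg2 : ContinuousAt ((Icc (-r) r).indicator g) 0 := by
    have hn : Icc (-r) r ∈ nhds (0 : ℝ) := Icc_mem_nhds (by linarith) hr
    refine (hg.continuousAt hn).congr ?_
    filter_upwards [hn] with x hx
    rw [indicator_of_mem hx]
  have hlim := tendsto_integral_comp_smul_smul_of_integrable (μ := MeasureTheory.volume)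
    (φ := fun x : ℝ => c0⁻¹ * exp (-(1 / 4) * x ^ 2)) (fun x => by positivity)
    (by rw [MeasureTheory.integral_const_mul, integral_gaussian]; exact inv_mul_cancel₀ hc0p.ne')
    (by
      have := (tendsto_rpow_abs_mul_exp_neg_mul_sq_cocompact (a := 1 / 4) (by norm_num) 1).const_mul c0⁻¹
      rw [Metric.cobounded_eq_cocompact]
      simp only [Module.finrank_self, pow_one, Real.norm_eq_abs]
      simp only [rpow_one, mul_zero] at this
      refine this.congr fun x => ?_
      ring) hg1 hg2
  have hc : Filter.Tendsto (fun δ : ℝ => √δ⁻¹) (nhdsWithin 0 (Ioi 0)) Filter.atTop :=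
    Real.tendsto_sqrt_atTop.comp tendsto_inv_nhdsGT_zero
  have h2 := (hlim.comp hc).const_mul c0
  rw [indicator_of_mem (show (0 : ℝ) ∈ Icc (-r) r from ⟨by linarith, hr.le⟩)] at h2
  refine h2.congr' ?_
  filter_upwards [self_mem_nhdsWithin] with δ hδ
  have hδ0 : (0 : ℝ) < δ := hδ
  simp only [Function.comp, Module.finrank_self, pow_one, smul_eq_mul]
  rw [intervalIntegral.integral_of_le hrr, ← MeasureTheory.integral_Icc_eq_integral_Ioc,
    ← MeasureTheory.integral_indicator measurableSet_Icc, ← MeasureTheory.integral_const_mul]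
  congr 1
  ext x
  by_cases hx : x ∈ Icc (-r) r
  · rw [indicator_of_mem hx, indicator_of_mem hx]
    unfold K0
    rw [mul_pow, Real.sq_sqrt (by positivity : (0 : ℝ) ≤ δ⁻¹)]
    have e : -(1 / 4) * (δ⁻¹ * x ^ 2) = -(x ^ 2 / 4) * δ⁻¹ := by ring
    rw [e]
    field_simp
  · rw [indicator_of_notMem hx, indicator_of_notMem hx]; simp

lemma bump_exists : ∃ η η1 η2 : ℝ → ℝ, ∃ B : ℝ, 0 < B ∧
    (∀ x, HasDerivAt η (η1 x) x) ∧ (∀ x, HasDerivAt η1 (η2 x) x) ∧ Continuous η2 ∧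
    (∀ x, 0 ≤ η x ∧ η x ≤ 1) ∧ (∀ x, |η1 x| ≤ B) ∧ (∀ x, |η2 x| ≤ B) ∧
    (∀ x, |x| < 31 / 40 → η x = 1 ∧ η1 x = 0 ∧ η2 x = 0) ∧
    (∀ x, 4 / 5 < |x| → η x = 0 ∧ η1 x = 0 ∧ η2 x = 0) := by
  let f : ContDiffBump (0 : ℝ) := ⟨31 / 40, 4 / 5, by norm_num, by norm_num⟩
  have hf : ContDiff ℝ (⊤ : ℕ∞) f := f.contDiff
  have hf1 : ContDiff ℝ (⊤ : ℕ∞) (deriv f) := hf.deriv'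
  have hf2 : ContDiff ℝ (⊤ : ℕ∞) (deriv (deriv f)) := hf1.deriv'
  obtain ⟨B1, hB1⟩ := f.hasCompactSupport.deriv.exists_bound_of_continuous hf1.continuous
  obtain ⟨B2, hB2⟩ := f.hasCompactSupport.deriv.deriv.exists_bound_of_continuous hf2.continuous
  refine ⟨f, deriv f, deriv (deriv f), max 1 (max B1 B2), by positivity,
    fun x => (hf.differentiable (by simp) x).hasDerivAt,
    fun x => (hf1.differentiable (by simp) x).hasDerivAt, hf2.continuous,
    fun x => ⟨f.nonneg, f.le_one⟩, fun x => (hB1 x).trans (by simp), fun x => (hB2 x).trans (by simp),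
    fun x hx => ?_, fun x hx => ?_⟩
  · have h0 : f =ᶠ[nhds x] fun _ => (1 : ℝ) := by
      apply f.eventuallyEq_one_of_mem_ball
      simpa [f] using hx
    refine ⟨h0.eq_of_nhds, ?_, ?_⟩
    · rw [h0.deriv_eq]; simp
    · rw [h0.deriv.deriv_eq]; simp
  · have h0 : f =ᶠ[nhds x] fun _ => (0 : ℝ) := by
      filter_upwards [(isOpen_lt continuous_const continuous_abs).mem_nhds hx] with y hy
      apply f.zero_of_le_dist
      simpa [f] using le_of_lt hy
    refine ⟨h0.eq_of_nhds, ?_, ?_⟩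
    · rw [h0.deriv_eq]; simp
    · rw [h0.deriv.deriv_eq]; simp

lemma kernel_test {A A1 A2 : ℝ → ℝ → ℝ} {η η1 η2 : ℝ → ℝ} {r a δ c : ℝ} (hδ : 0 < δ)
    (hA : Continuous (fun p : ℝ × ℝ => A p.1 p.2)) (hA1 : Continuous (fun p : ℝ × ℝ => A1 p.1 p.2))
    (hA2 : Continuous (fun p : ℝ × ℝ => A2 p.1 p.2))
    (dA : ∀ u x, HasDerivAt (fun y => A y u) (A1 x u) x)
    (dA1 : ∀ u x, HasDerivAt (fun y => A1 y u) (A2 x u) x)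
    (dAs : ∀ s, 0 < s → ∀ x, HasDerivAt (fun s => A x s⁻¹) (A2 x s⁻¹) s)
    (dη : ∀ x, HasDerivAt η (η1 x) x) (dη1 : ∀ x, HasDerivAt η1 (η2 x) x) (hη2 : Continuous η2)
    (hz : η r = 0 ∧ η (-r) = 0) :
    TestFn r a 0 (fun x t => A x (δ - t)⁻¹ * (exp (c * t) * η x))
      (fun x t => exp (c * t) * (A1 x (δ - t)⁻¹ * η x + A x (δ - t)⁻¹ * η1 x))
      (fun x t => exp (c * t) *
        (A2 x (δ - t)⁻¹ * η x + 2 * A1 x (δ - t)⁻¹ * η1 x + A x (δ - t)⁻¹ * η2 x))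
      (fun x t => exp (c * t) * (-A2 x (δ - t)⁻¹ * η x + c * A x (δ - t)⁻¹ * η x)) := by
  have cη : Continuous η := continuous_iff_continuousAt.2 fun x => (dη x).continuousAt
  have cη1 : Continuous η1 := continuous_iff_continuousAt.2 fun x => (dη1 x).continuousAt
  have cu : ContinuousOn (fun p : ℝ × ℝ => (δ - p.2)⁻¹) (univ ×ˢ Icc a 0) := by
    refine ContinuousOn.inv₀ (by fun_prop) ?_
    rintro ⟨x, t⟩ ⟨_, ht⟩
    have := ht.2
    simp only at this ⊢
    linarith
  have cp : ContinuousOn (fun p : ℝ × ℝ => (p.1, (δ - p.2)⁻¹)) (univ ×ˢ Icc a 0) :=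
    continuousOn_fst.prodMk cu
  have kA := hA.comp_continuousOn cp
  have kA1 := hA1.comp_continuousOn cp
  have kA2 := hA2.comp_continuousOn cp
  simp only [Function.comp_def] at kA kA1 kA2
  refine ⟨?_, ?_, ?_, ?_, ?_, ?_, ?_⟩
  · intro t ht x
    refine ((dA _ x).mul ((dη x).const_mul (exp (c * t)))).congr_deriv ?_
    ring
  · intro t ht x
    refine ((((dA1 _ x).mul (dη x)).add ((dA _ x).mul (dη1 x))).const_mul (exp (c * t))).congr_deriv ?_
    ring
  · intro t ht x
    have h1 : HasDerivAt (fun s : ℝ => δ - s) (-1) t := (hasDerivAt_id t).const_sub δ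
    have h2 := (dAs (δ - t) (by linarith [ht.2]) x).scomp t h1
    have h3 : HasDerivAt (fun s => exp (c * s)) (exp (c * t) * c) t := by
      have := ((hasDerivAt_id t).const_mul c).exp
      simpa using this
    refine (h2.mul (h3.mul_const (η x))).congr_deriv ?_
    simp only [Function.comp, smul_eq_mul]
    ring
  · fun_prop
  · fun_prop
  · fun_prop
  · intro t ht
    simp [hz.1, hz.2]

lemma rho_facts {r x : ℝ} (hr2 : 3 / 4 ≤ r ^ 2) :
    0 ≤ 9 * (r ^ 2 - x ^ 2) ^ 2 - 12 * (r ^ 2 - x ^ 2) + 8 * r ^ 2 - 2 := by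
  nlinarith [sq_nonneg (3 * (r ^ 2 - x ^ 2) - 2)]

lemma sq_le_of_mem {r x : ℝ} (hx : x ∈ Icc (-r) r) : 0 ≤ r ^ 2 - x ^ 2 := by
  nlinarith [hx.1, hx.2]

lemma abs_mem {r x : ℝ} (hx : x ∈ Icc (-r) r) : |x| ≤ r := abs_le.2 hx

lemma cont_slice_h {h : ℝ → ℝ → ℝ} (H : IsHeatSolution h) {r t : ℝ} (hr1 : r < 1)
    (ht : t ∈ Icc (-1 : ℝ) 0) : ContinuousOn (fun x => h x t) (Icc (-r) r) :=
  (slice_cont H.1 ht).mono (Icc_subset_Icc (by linarith) hr1.le)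

lemma K0_slice_c (u : ℝ) : Continuous (fun x => K0 x u) :=
  K0_c.comp (by fun_prop : Continuous fun x : ℝ => (x, u))

lemma step1 {h : ℝ → ℝ → ℝ} (H : IsHeatSolution h)
    (hh : ∀ x ∈ Set.Icc (-1 : ℝ) 1, ∀ t ∈ Set.Icc (-1 : ℝ) 0, 0 ≤ h x t)
    {r δ s : ℝ} (hr : 0 < r) (hr1 : r < 1) (hr2 : 3 / 4 ≤ r ^ 2) (hδ : 0 < δ)
    (hs : 0 < s) (hs1 : s < 1) :
    ∫ x in (-r)..r, h x (-s) * (K0 x (δ + s)⁻¹ * (r ^ 2 - x ^ 2) ^ 2) ≤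
      exp 9 * ∫ x in (-r)..r, h x 0 * (K0 x δ⁻¹ * (r ^ 2 - x ^ 2) ^ 2) := by
  have hrr : -r ≤ r := by linarith
  have dη : ∀ x : ℝ, HasDerivAt (fun x : ℝ => -(r ^ 2 - x ^ 2) ^ 2) (4 * x * (r ^ 2 - x ^ 2)) x := by
    intro x
    have h1 : HasDerivAt (fun x : ℝ => r ^ 2 - x ^ 2) (-(2 * x)) x := by
      have := (hasDerivAt_pow 2 x).const_sub (r ^ 2)
      refine this.congr_deriv ?_
      norm_num
    refine ((h1.pow 2).neg).congr_deriv ?_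
    norm_num; ring
  have dη1 : ∀ x : ℝ, HasDerivAt (fun x : ℝ => 4 * x * (r ^ 2 - x ^ 2)) (4 * r ^ 2 - 12 * x ^ 2) x := by
    intro x
    have h1 : HasDerivAt (fun x : ℝ => r ^ 2 - x ^ 2) (-(2 * x)) x := by
      have := (hasDerivAt_pow 2 x).const_sub (r ^ 2)
      refine this.congr_deriv ?_
      norm_num
    refine (((hasDerivAt_id x).const_mul 4).mul h1).congr_deriv ?_
    simp only [id]; ring
  have T := kernel_test (A := K0) (A1 := K1) (A2 := K2) (r := r) (a := -s) (c := 9) hδ K0_c K1_c K2_c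
    K0_dx K1_dx (fun s hs x => K0_ds hs x) dη dη1 (by fun_prop) (by simp)
  have key := key_ineq H (C := 0) hr hr1 (by linarith) (by linarith) le_rfl T (by
    intro t ht
    have hneg : ∫ x in (-r)..r, h x t * (exp (9 * t) * (-K2 x (δ - t)⁻¹ * -(r ^ 2 - x ^ 2) ^ 2 +
        9 * K0 x (δ - t)⁻¹ * -(r ^ 2 - x ^ 2) ^ 2) + exp (9 * t) *
        (K2 x (δ - t)⁻¹ * -(r ^ 2 - x ^ 2) ^ 2 + 2 * K1 x (δ - t)⁻¹ * (4 * x * (r ^ 2 - x ^ 2)) +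
          K0 x (δ - t)⁻¹ * (4 * r ^ 2 - 12 * x ^ 2))) ≤ 0 := by
      rw [← neg_nonneg, ← intervalIntegral.integral_neg]
      refine intervalIntegral.integral_nonneg hrr ?_
      intro x hx
      have h0 : 0 ≤ h x t := hh x ⟨by linarith [hx.1], by linarith [hx.2]⟩ t
        ⟨by linarith [ht.1], ht.2.le⟩
      have hu : 0 ≤ (δ - t)⁻¹ := inv_nonneg.2 (by linarith [ht.2])
      have hz := sq_le_of_mem hx
      have hk := K0_nonneg x (δ - t)⁻¹
      have hf := rho_facts (x := x) hr2
      have : -(h x t * (exp (9 * t) * (-K2 x (δ - t)⁻¹ * -(r ^ 2 - x ^ 2) ^ 2 +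
        9 * K0 x (δ - t)⁻¹ * -(r ^ 2 - x ^ 2) ^ 2) + exp (9 * t) *
        (K2 x (δ - t)⁻¹ * -(r ^ 2 - x ^ 2) ^ 2 + 2 * K1 x (δ - t)⁻¹ * (4 * x * (r ^ 2 - x ^ 2)) +
          K0 x (δ - t)⁻¹ * (4 * r ^ 2 - 12 * x ^ 2)))) =
          h x t * (exp (9 * t) * (K0 x (δ - t)⁻¹ * (4 * (x ^ 2 * ((r ^ 2 - x ^ 2) * (δ - t)⁻¹))
           + (9 * (r ^ 2 - x ^ 2) ^ 2 - 12 * (r ^ 2 - x ^ 2) + 8 * r ^ 2 - 2) + 2))) := by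
        simp only [K1]; ring
      rw [this]
      positivity
    have e1 : (r ^ 2 - (-r) ^ 2) = 0 := by ring
    simp only [e1, sub_self]
    nlinarith [hneg])
  have e0 : (∫ x in (-r)..r, h x 0 * (K0 x (δ - 0)⁻¹ * (exp (9 * 0) * -(r ^ 2 - x ^ 2) ^ 2))) =
      - ∫ x in (-r)..r, h x 0 * (K0 x δ⁻¹ * (r ^ 2 - x ^ 2) ^ 2) := by
    rw [← intervalIntegral.integral_neg]
    congr 1; ext x; simp
  have e1 : (∫ x in (-r)..r, h x (-s) * (K0 x (δ - (-s))⁻¹ * (exp (9 * (-s)) * -(r ^ 2 - x ^ 2) ^ 2))) =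
      - (exp (-(9 * s)) * ∫ x in (-r)..r, h x (-s) * (K0 x (δ + s)⁻¹ * (r ^ 2 - x ^ 2) ^ 2)) := by
    rw [← intervalIntegral.integral_const_mul, ← intervalIntegral.integral_neg]
    congr 1; ext x; rw [sub_neg_eq_add, mul_neg]; ring
  rw [e0, e1] at key
  set X := ∫ x in (-r)..r, h x (-s) * (K0 x (δ + s)⁻¹ * (r ^ 2 - x ^ 2) ^ 2) with hX
  set Y := ∫ x in (-r)..r, h x 0 * (K0 x δ⁻¹ * (r ^ 2 - x ^ 2) ^ 2) with hY
  have hXn : 0 ≤ X := by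
    refine intervalIntegral.integral_nonneg hrr ?_
    intro x hx
    have h0 : 0 ≤ h x (-s) := hh x ⟨by linarith [hx.1], by linarith [hx.2]⟩ (-s)
        ⟨by linarith, by linarith⟩
    have := K0_nonneg x (δ + s)⁻¹
    positivity
  have h1 : exp (-9) * X ≤ Y := by
    have : exp (-9) ≤ exp (-(9 * s)) := Real.exp_le_exp.2 (by linarith)
    nlinarith
  calc X = exp 9 * (exp (-9) * X) := by rw [← mul_assoc, ← Real.exp_add]; simp
    _ ≤ exp 9 * Y := by gcongr

lemma step1_lim {h : ℝ → ℝ → ℝ} (H : IsHeatSolution h) {r : ℝ} (hr : 0 < r) (hr1 : r < 1) :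
    Filter.Tendsto (fun δ : ℝ => ∫ x in (-r)..r, h x 0 * (K0 x δ⁻¹ * (r ^ 2 - x ^ 2) ^ 2))
      (nhdsWithin 0 (Ioi 0)) (nhds (√(π / (1 / 4)) * (h 0 0 * r ^ 4))) := by
  have hc : ContinuousOn (fun x => h x 0 * (r ^ 2 - x ^ 2) ^ 2) (Icc (-r) r) :=
    (cont_slice_h H hr1 ⟨by norm_num, le_rfl⟩).mul (by fun_prop)
  have := delta_lim hr hc
  convert this using 2
  · congr 1; ext x; ring
  · ring

lemma step1b {h : ℝ → ℝ → ℝ} (H : IsHeatSolution h)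
    (hh : ∀ x ∈ Set.Icc (-1 : ℝ) 1, ∀ t ∈ Set.Icc (-1 : ℝ) 0, 0 ≤ h x t)
    {r s : ℝ} (hr : 0 < r) (hr1 : r < 1) (hr2 : 3 / 4 ≤ r ^ 2)
    (hs : 1 / 2 ≤ s) (hs1 : s ≤ 3 / 4) :
    ∫ x in (-r)..r, h x (-s) * (r ^ 2 - x ^ 2) ^ 2 ≤ exp (19 / 2) * √(π / (1 / 4)) * h 0 0 := by
  have hrr : -r ≤ r := by linarith
  have h00 : 0 ≤ h 0 0 := hh 0 (by simp) 0 (by simp)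
  have hlim := (step1_lim H hr hr1).const_mul (exp (1 / 2) * exp 9)
  have hle : (exp (1 / 2) * exp 9) * (√(π / (1 / 4)) * (h 0 0 * r ^ 4)) ≤
      exp (19 / 2) * √(π / (1 / 4)) * h 0 0 := by
    rw [← Real.exp_add]
    have : (1 / 2 + 9 : ℝ) = 19 / 2 := by norm_num
    rw [this, mul_assoc]
    have : r ^ 4 ≤ 1 := pow_le_one₀ hr.le hr1.le
    gcongr
    nlinarith
  refine le_trans (ge_of_tendsto hlim ?_) hle
  filter_upwards [Ioo_mem_nhdsGT (show (0 : ℝ) < 1 / 4 by norm_num)] with δ hδ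
  have h1 := step1 H hh hr hr1 hr2 hδ.1 (by linarith : 0 < s) (by linarith)
  rw [mul_assoc]
  refine le_trans ?_ (mul_le_mul_of_nonneg_left h1 (Real.exp_pos _).le)
  rw [← intervalIntegral.integral_const_mul]
  have hc := cont_slice_h H hr1 (t := -s) ⟨by linarith, by linarith⟩
  have hk := K0_slice_c (δ + s)⁻¹
  refine intervalIntegral.integral_mono_on hrr ?_ ?_ ?_
  · apply ContinuousOn.intervalIntegrable
    rw [uIcc_of_le hrr]; fun_prop
  · apply ContinuousOn.intervalIntegrable
    rw [uIcc_of_le hrr]; fun_prop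
  · intro x hx
    have h0 : 0 ≤ h x (-s) := hh x ⟨by linarith [hx.1], by linarith [hx.2]⟩ (-s)
        ⟨by linarith, by linarith⟩
    have hk1 : exp (-(1 / 2)) ≤ K0 x (δ + s)⁻¹ := by
      have hu1 : 1 ≤ (δ + s)⁻¹ := (one_le_inv₀ (by linarith [hδ.1])).2 (by linarith [hδ.2])
      have hu2 : (δ + s)⁻¹ ≤ 2 := by
        rw [inv_le_comm₀ (by linarith [hδ.1]) (by norm_num)]; linarith [hδ.1]
      have hx1 : x ^ 2 ≤ 1 := by nlinarith [sq_le_of_mem hx]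
      unfold K0
      have a1 : 1 ≤ √(δ + s)⁻¹ := Real.one_le_sqrt.2 hu1
      have a2 : exp (-(1 / 2)) ≤ exp (-(x ^ 2 / 4) * (δ + s)⁻¹) := by
        apply Real.exp_le_exp.2; nlinarith [sq_nonneg x]
      nlinarith [Real.exp_pos (-(x ^ 2 / 4) * (δ + s)⁻¹)]
    have hk2 : 1 ≤ exp (1 / 2) * K0 x (δ + s)⁻¹ := by
      calc (1 : ℝ) = exp (1 / 2) * exp (-(1 / 2)) := by rw [← Real.exp_add]; simp
        _ ≤ _ := by gcongr
    have : 0 ≤ h x (-s) * (r ^ 2 - x ^ 2) ^ 2 := by positivity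
    calc h x (-s) * (r ^ 2 - x ^ 2) ^ 2 ≤ (h x (-s) * (r ^ 2 - x ^ 2) ^ 2) * (exp (1 / 2) * K0 x (δ + s)⁻¹) :=
          le_mul_of_one_le_right this hk2
      _ = _ := by ring

lemma parab_test (r a b α : ℝ) (β : ℝ) :
    TestFn r a b (fun x t => (α * t + β) * (r ^ 2 - x ^ 2) - α * (r ^ 2 - x ^ 2) ^ 2)
      (fun x t => (α * t + β) * (-(2 * x)) + α * (4 * x * (r ^ 2 - x ^ 2)))
      (fun x t => (α * t + β) * (-2) + α * (4 * r ^ 2 - 12 * x ^ 2))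
      (fun x t => α * (r ^ 2 - x ^ 2)) := by
  have h1 : ∀ x : ℝ, HasDerivAt (fun x : ℝ => r ^ 2 - x ^ 2) (-(2 * x)) x := by
    intro x
    have := (hasDerivAt_pow 2 x).const_sub (r ^ 2)
    refine this.congr_deriv ?_
    norm_num
  refine ⟨?_, ?_, ?_, ?_, ?_, ?_, ?_⟩
  · intro t ht x
    refine (((h1 x).const_mul (α * t + β)).sub (((h1 x).pow 2).const_mul α)).congr_deriv ?_
    norm_num; left; ring
  · intro t ht x
    have h2 : HasDerivAt (fun x : ℝ => -(2 * x)) (-2) x := by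
      refine (((hasDerivAt_id x).const_mul 2).neg).congr_deriv ?_
      norm_num
    refine ((h2.const_mul (α * t + β)).add
      ((((hasDerivAt_id x).const_mul 4).mul (h1 x)).const_mul α)).congr_deriv ?_
    simp only [id]; ring
  · intro t ht x
    have h2 : HasDerivAt (fun t : ℝ => α * t + β) α t := by
      simpa using ((hasDerivAt_id t).const_mul α).add_const β
    exact (h2.mul_const (r ^ 2 - x ^ 2)).sub_const _
  · fun_prop
  · fun_prop
  · fun_prop
  · intro t ht; simp

lemma step2 {h : ℝ → ℝ → ℝ} (H : IsHeatSolution h)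
    (hh : ∀ x ∈ Set.Icc (-1 : ℝ) 1, ∀ t ∈ Set.Icc (-1 : ℝ) 0, 0 ≤ h x t)
    {r t M : ℝ} (hr : 0 < r) (hr1 : r < 1) (hr2 : 3 / 4 ≤ r ^ 2)
    (hM : ∀ t ∈ Icc (-1 : ℝ) 0, h r t ≤ M ∧ h (-r) t ≤ M)
    (ht : t ∈ Icc (-(1 / 2) : ℝ) 0) :
    ∫ x in (-r)..r, h x t * (r ^ 2 - x ^ 2) ≤
      13 * (exp (19 / 2) * √(π / (1 / 4)) * h 0 0) + 3 * M := by
  have hrr : -r ≤ r := by linarith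
  set Q := exp (19 / 2) * √(π / (1 / 4)) * h 0 0 with hQ
  have e1 : (r ^ 2 - (-r) ^ 2) = 0 := by ring
  have hM0 : 0 ≤ M := (hh r ⟨by linarith, hr1.le⟩ 0 (by simp)).trans (hM 0 (by simp)).1
  have hn : ∀ t ∈ Icc (-1 : ℝ) 0, ∀ x ∈ Icc (-r) r, 0 ≤ h x t := fun t ht x hx =>
    hh x ⟨by linarith [hx.1], by linarith [hx.2]⟩ t ht
  have hint : ∀ t ∈ Icc (-1 : ℝ) 0, ∀ g : ℝ → ℝ, Continuous g →
      IntervalIntegrable (fun x => h x t * g x) MeasureTheory.volume (-r) r := by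
    intro t ht g hg
    apply ContinuousOn.intervalIntegrable
    rw [uIcc_of_le hrr]
    exact (cont_slice_h H hr1 ht).mul hg.continuousOn
  have A := key_ineq H (C := 9 * Q + M) hr hr1 (a := -(3 / 4)) (b := -(1 / 2)) (by norm_num)
    (by norm_num) (by norm_num) (parab_test r (-(3 / 4)) (-(1 / 2)) 1 (3 / 4)) (by
      intro t ht
      have ht1 : t ∈ Icc (-1 : ℝ) 0 := ⟨by linarith [ht.1], by linarith [ht.2]⟩
      have b1 := step1b H hh hr hr1 hr2 (s := -t) (by linarith [ht.2]) (by linarith [ht.1])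
      rw [neg_neg] at b1
      have b2 : ∫ x in (-r)..r, h x t * (1 * (r ^ 2 - x ^ 2) + ((1 * t + 3 / 4) * (-2) +
          1 * (4 * r ^ 2 - 12 * x ^ 2))) ≤ ∫ x in (-r)..r, 9 * (h x t * (r ^ 2 - x ^ 2) ^ 2) := by
        refine intervalIntegral.integral_mono_on hrr (hint t ht1 _ (by fun_prop))
          ((hint t ht1 _ (by fun_prop)).const_mul 9) ?_
        intro x hx
        have h0 := hn t ht1 x hx
        have hf := rho_facts (x := x) hr2
        have hz := sq_le_of_mem hx
        have : (1 * (r ^ 2 - x ^ 2) + ((1 * t + 3 / 4) * (-2) + 1 * (4 * r ^ 2 - 12 * x ^ 2))) ≤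
            9 * (r ^ 2 - x ^ 2) ^ 2 := by
          nlinarith [ht.1]
        calc _ ≤ h x t * (9 * (r ^ 2 - x ^ 2) ^ 2) := mul_le_mul_of_nonneg_left this h0
          _ = _ := by ring
      rw [intervalIntegral.integral_const_mul] at b2
      have c1 := hM t ht1
      have c2 := hn t ht1 r ⟨hrr, le_rfl⟩
      have c3 := hn t ht1 (-r) ⟨le_rfl, hrr⟩
      simp only [e1, sub_self]
      have : (t + 3 / 4) * r ≤ 1 / 4 := by nlinarith [ht.1, ht.2]
      have : 0 ≤ (t + 3 / 4) * r := by nlinarith [ht.1, ht.2]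
      nlinarith)
  have B1 := step1b H hh hr hr1 hr2 (s := 1 / 2) le_rfl (by norm_num)
  have A1 : (∫ x in (-r)..r, h x (-(1 / 2)) * ((1 * -(1 / 2) + 3 / 4) * (r ^ 2 - x ^ 2) - 1 * (r ^ 2 - x ^ 2) ^ 2)) =
      1 / 4 * (∫ x in (-r)..r, h x (-(1 / 2)) * (r ^ 2 - x ^ 2)) -
        ∫ x in (-r)..r, h x (-(1 / 2)) * (r ^ 2 - x ^ 2) ^ 2 := by
    have hm : (-(1 / 2) : ℝ) ∈ Icc (-1 : ℝ) 0 := by constructor <;> norm_num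
    rw [← intervalIntegral.integral_const_mul, ← intervalIntegral.integral_sub
      ((hint _ hm _ (by fun_prop)).const_mul _) (hint _ hm _ (by fun_prop))]
    congr 1; ext x; ring
  have A2 : (∫ x in (-r)..r, h x (-(3 / 4)) * ((1 * -(3 / 4) + 3 / 4) * (r ^ 2 - x ^ 2) - 1 * (r ^ 2 - x ^ 2) ^ 2)) ≤ 0 := by
    rw [← neg_nonneg, ← intervalIntegral.integral_neg]
    refine intervalIntegral.integral_nonneg hrr ?_
    intro x hx
    have := hn (-(3 / 4)) ⟨by norm_num, by norm_num⟩ x hx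
    have e : -(h x (-(3 / 4)) * ((1 * -(3 / 4) + 3 / 4) * (r ^ 2 - x ^ 2) - 1 * (r ^ 2 - x ^ 2) ^ 2)) =
      h x (-(3 / 4)) * (r ^ 2 - x ^ 2) ^ 2 := by ring
    rw [e]; positivity
  rw [A1] at A
  have half : (∫ x in (-r)..r, h x (-(1 / 2)) * (r ^ 2 - x ^ 2)) ≤ 13 * Q + M := by linarith
  rcases eq_or_lt_of_le ht.1 with h1 | h1
  · rw [← h1]; linarith
  have D := key_ineq H (C := 4 * M) hr hr1 (a := -(1 / 2)) (b := t) (by norm_num)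
    h1 ht.2 (parab_test r (-(1 / 2)) t 0 1) (by
      intro τ hτ
      have ht1 : τ ∈ Icc (-1 : ℝ) 0 := ⟨by linarith [hτ.1], by linarith [hτ.2, ht.2]⟩
      have b2 : ∫ x in (-r)..r, h x τ * (0 * (r ^ 2 - x ^ 2) + ((0 * τ + 1) * (-2) +
          0 * (4 * r ^ 2 - 12 * x ^ 2))) ≤ 0 := by
        rw [← neg_nonneg, ← intervalIntegral.integral_neg]
        refine intervalIntegral.integral_nonneg hrr ?_
        intro x hx
        have := hn τ ht1 x hx
        linarith
      have c1 := hM τ ht1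
      have c2 := hn τ ht1 r ⟨hrr, le_rfl⟩
      have c3 := hn τ ht1 (-r) ⟨le_rfl, hrr⟩
      simp only [e1, sub_self]
      nlinarith)
  have e3 : ∀ τ, (∫ x in (-r)..r, h x τ * ((0 * τ + 1) * (r ^ 2 - x ^ 2) - 0 * (r ^ 2 - x ^ 2) ^ 2)) =
      ∫ x in (-r)..r, h x τ * (r ^ 2 - x ^ 2) := by
    intro τ; congr 1; ext x; ring
  rw [e3, e3] at D
  have : 4 * M * (t - -(1 / 2)) ≤ 2 * M := by nlinarith [ht.2]
  linarith

set_option maxHeartbeats 2000000 in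
lemma step3 {h : ℝ → ℝ → ℝ} (H : IsHeatSolution h)
    (hh : ∀ x ∈ Set.Icc (-1 : ℝ) 1, ∀ t ∈ Set.Icc (-1 : ℝ) 0, 0 ≤ h x t)
    {η η1 η2 : ℝ → ℝ} {B : ℝ} (hB : 0 < B)
    (dη : ∀ x, HasDerivAt η (η1 x) x) (dη1 : ∀ x, HasDerivAt η1 (η2 x) x) (cη2 : Continuous η2)
    (bη : ∀ x, |η x| ≤ 1) (bη1 : ∀ x, |η1 x| ≤ B) (bη2 : ∀ x, |η2 x| ≤ B)
    (zi : ∀ x, |x| < 31 / 40 → η1 x = 0 ∧ η2 x = 0)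
    (zo : ∀ x, 4 / 5 < |x| → η x = 0 ∧ η1 x = 0 ∧ η2 x = 0)
    {r M m δ : ℝ} (hr : 0 < r) (hr1 : r < 1) (hr2 : 3 / 4 ≤ r ^ 2)
    (hM : ∀ t ∈ Icc (-1 : ℝ) 0, h r t ≤ M ∧ h (-r) t ≤ M)
    (hm : 0 < m) (hm1 : m ≤ 1 / 2) (hδ : 0 < δ) (hδm : δ < m / 8) :
    ∫ x in (-r)..r, h x 0 * (K2 x δ⁻¹ * η x) ≤
      100 / m ^ 2 * exp 9 * (∫ x in (-r)..r, h x 0 * (K0 x δ⁻¹ * (r ^ 2 - x ^ 2) ^ 2)) +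
      30 * B * (24 / (3 / 320) ^ 4) * exp (-(1 / (8 * m))) *
        (13 * (exp (19 / 2) * √(π / (1 / 4)) * h 0 0) + 3 * M) := by
  have hrr : -r ≤ r := by linarith
  have hr45 : 4 / 5 < r := by nlinarith
  have cη : Continuous η := continuous_iff_continuousAt.2 fun x => (dη x).continuousAt
  have cη1 : Continuous η1 := continuous_iff_continuousAt.2 fun x => (dη1 x).continuousAt
  have zr := zo r (by rwa [abs_of_pos hr])
  have zr' := zo (-r) (by rwa [abs_neg, abs_of_pos hr])
  set E := 13 * (exp (19 / 2) * √(π / (1 / 4)) * h 0 0) + 3 * M with hE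
  set P := 30 * B * (24 / (3 / 320) ^ 4) * exp (-(1 / (8 * m))) with hP
  have hP0 : 0 ≤ P := by positivity
  have hM0 : 0 ≤ M := (hh r ⟨by linarith, hr1.le⟩ 0 (by simp)).trans (hM 0 (by simp)).1
  have h00 : 0 ≤ h 0 0 := hh 0 (by simp) 0 (by simp)
  have hE0 : 0 ≤ E := by positivity
  have hn : ∀ t ∈ Icc (-1 : ℝ) 0, ∀ x ∈ Icc (-r) r, 0 ≤ h x t := fun t ht x hx =>
    hh x ⟨by linarith [hx.1], by linarith [hx.2]⟩ t ht
  have hint : ∀ t ∈ Icc (-1 : ℝ) 0, ∀ g : ℝ → ℝ, Continuous g →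
      IntervalIntegrable (fun x => h x t * g x) MeasureTheory.volume (-r) r := by
    intro t ht g hg
    apply ContinuousOn.intervalIntegrable
    rw [uIcc_of_le hrr]
    exact (cont_slice_h H hr1 ht).mul hg.continuousOn
  have cK0 : ∀ u, Continuous (fun x => K0 x u) := K0_slice_c
  have cK2 : ∀ u, Continuous (fun x => K2 x u) := fun u =>
    K2_c.comp (by fun_prop : Continuous fun x : ℝ => (x, u))
  have cK3 : ∀ u, Continuous (fun x => K3 x u) := fun u =>
    K3_c.comp (by fun_prop : Continuous fun x : ℝ => (x, u))
  have cK4 : ∀ u, Continuous (fun x => K4 x u) := fun u =>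
    K4_c.comp (by fun_prop : Continuous fun x : ℝ => (x, u))
  have hz10 : ∀ x : ℝ, |x| ≤ 4 / 5 → 1 / 10 ≤ r ^ 2 - x ^ 2 := by
    intro x hx
    have : x ^ 2 ≤ (4 / 5) ^ 2 := by rw [← sq_abs]; gcongr
    linarith
  have T := kernel_test (A := K2) (A1 := K3) (A2 := K4) (r := r) (a := -m) (c := 0) hδ K2_c K3_c K4_c
    K2_dx K3_dx (fun s hs x => K2_ds hs x) dη dη1 cη2 ⟨zr.1, zr'.1⟩
  have key := key_ineq H (C := P * E) hr hr1 (by linarith) (by linarith) le_rfl T (by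
    intro t ht
    have ht1 : t ∈ Icc (-1 : ℝ) 0 := ⟨by linarith [ht.1], ht.2.le⟩
    rw [zr.1, zr'.1, zr.2.1, zr'.2.1]
    have b2 : ∫ x in (-r)..r, h x t * (exp (0 * t) * (-K4 x (δ - t)⁻¹ * η x + 0 * K2 x (δ - t)⁻¹ * η x) +
        exp (0 * t) * (K4 x (δ - t)⁻¹ * η x + 2 * K3 x (δ - t)⁻¹ * η1 x + K2 x (δ - t)⁻¹ * η2 x)) ≤
        ∫ x in (-r)..r, P * (h x t * (r ^ 2 - x ^ 2)) := by
      have c0 := cK0 (δ - t)⁻¹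
      have c2 := cK2 (δ - t)⁻¹
      have c3 := cK3 (δ - t)⁻¹
      have c4 := cK4 (δ - t)⁻¹
      refine intervalIntegral.integral_mono_on hrr (hint t ht1 _ (by fun_prop))
          ((hint t ht1 _ (by fun_prop)).const_mul P) ?_
      intro x hx
      have h0 := hn t ht1 x hx
      have hz := sq_le_of_mem hx
      have hx1 : |x| ≤ 1 := (abs_mem hx).trans hr1.le
      have hdt : 0 < δ - t := by linarith [ht.2]
      have hu : 1 ≤ (δ - t)⁻¹ := (one_le_inv₀ hdt).2 (by linarith [ht.1])
      have main : 2 * K3 x (δ - t)⁻¹ * η1 x + K2 x (δ - t)⁻¹ * η2 x ≤ P * (r ^ 2 - x ^ 2) := by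
        rcases lt_or_ge (|x|) (31 / 40) with hx2 | hx2
        · rw [(zi x hx2).1, (zi x hx2).2]
          simp only [mul_zero, add_zero]; positivity
        rcases lt_or_ge (4 / 5) (|x|) with hx3 | hx3
        · rw [(zo x hx3).2.1, (zo x hx3).2.2]
          simp only [mul_zero, add_zero]; positivity
        have hxs : 3 / 5 ≤ x ^ 2 := by
          have : (31 / 40 : ℝ) ^ 2 ≤ x ^ 2 := by rw [← sq_abs x]; gcongr
          linarith
        have g1 := K3_le hx1 hu
        have g2 := K2_le hx1 hu
        have g3 := K0_decay hxs hu
        have g0 := K0_nonneg x (δ - t)⁻¹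
        set u := (δ - t)⁻¹ with hudef
        have g4 : exp (-(9 / 64 * u)) ≤ exp (-(1 / (8 * m))) := by
          apply Real.exp_le_exp.2
          have : (9 / 8 * m)⁻¹ ≤ u := by
            rw [hudef]; apply inv_anti₀ hdt; linarith [ht.1]
          have e : 1 / (8 * m) = 9 / 64 * (9 / 8 * m)⁻¹ := by field_simp; norm_num
          rw [e]; linarith
        have g5 : u ^ 2 * K0 x u ≤ u ^ 3 * K0 x u := by gcongr; norm_num
        have t1 : 2 * K3 x u * η1 x ≤ 2 * (u ^ 3 * K0 x u) * B := by
          refine (le_abs_self _).trans ?_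
          rw [abs_mul, abs_mul, abs_two]
          gcongr
          exact bη1 x
        have t2 : K2 x u * η2 x ≤ (u ^ 3 * K0 x u) * B := by
          refine (le_abs_self _).trans ?_
          rw [abs_mul]
          exact mul_le_mul (g2.trans g5) (bη2 x) (abs_nonneg _) (by positivity)
        calc 2 * K3 x u * η1 x + K2 x u * η2 x ≤ 3 * B * (u ^ 3 * K0 x u) := by linarith
          _ ≤ 3 * B * (24 / (3 / 320) ^ 4 * exp (-(1 / (8 * m)))) := by
            refine mul_le_mul_of_nonneg_left (g3.trans ?_) (by positivity)
            exact mul_le_mul_of_nonneg_left g4 (by norm_num)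
          _ = P * (1 / 10) := by rw [hP]; ring
          _ ≤ P * (r ^ 2 - x ^ 2) := by
            gcongr
            exact hz10 x hx3
      calc _ = h x t * (2 * K3 x (δ - t)⁻¹ * η1 x + K2 x (δ - t)⁻¹ * η2 x) := by
            rw [zero_mul, Real.exp_zero]; ring
        _ ≤ h x t * (P * (r ^ 2 - x ^ 2)) := by gcongr
        _ = _ := by ring
    rw [intervalIntegral.integral_const_mul] at b2
    have b3 := step2 H hh hr hr1 hr2 hM (t := t) ⟨by linarith [ht.1], ht.2.le⟩
    have b4 := mul_le_mul_of_nonneg_left b3 hP0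
    simp only [mul_zero, add_zero, sub_zero]
    exact b2.trans b4)
  have s1 := step1 H hh hr hr1 hr2 hδ hm (by linarith)
  have hmm : -m ∈ Icc (-1 : ℝ) 0 := ⟨by linarith, by linarith⟩
  have I2 : ∫ x in (-r)..r, h x (-m) * (K2 x (δ - -m)⁻¹ * (exp (0 * -m) * η x)) ≤
      ∫ x in (-r)..r, 100 / m ^ 2 * (h x (-m) * (K0 x (δ + m)⁻¹ * (r ^ 2 - x ^ 2) ^ 2)) := by
    have c0 := cK0 (δ + m)⁻¹
    have c2 := cK2 (δ - -m)⁻¹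
    refine intervalIntegral.integral_mono_on hrr (hint _ hmm _ (by fun_prop))
          ((hint _ hmm _ (by fun_prop)).const_mul _) ?_
    intro x hx
    rw [sub_neg_eq_add, zero_mul, Real.exp_zero, one_mul]
    have h0 := hn _ hmm x hx
    have hx1 : |x| ≤ 1 := (abs_mem hx).trans hr1.le
    have hu : 1 ≤ (δ + m)⁻¹ := (one_le_inv₀ (by linarith)).2 (by linarith)
    have hum : (δ + m)⁻¹ ≤ m⁻¹ := inv_anti₀ hm (by linarith)
    have g2 := K2_le hx1 hu
    have g0 := K0_nonneg x (δ + m)⁻¹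
    have main : K2 x (δ + m)⁻¹ * η x ≤ 100 / m ^ 2 * (K0 x (δ + m)⁻¹ * (r ^ 2 - x ^ 2) ^ 2) := by
      rcases lt_or_ge (4 / 5) (|x|) with hx3 | hx3
      · rw [(zo x hx3).1, mul_zero]; positivity
      have hz := hz10 x hx3
      have hz2 : 1 ≤ 100 * (r ^ 2 - x ^ 2) ^ 2 := by nlinarith
      calc K2 x (δ + m)⁻¹ * η x ≤ |K2 x (δ + m)⁻¹| * |η x| := by rw [← abs_mul]; exact le_abs_self _
        _ ≤ ((δ + m)⁻¹ ^ 2 * K0 x (δ + m)⁻¹) * 1 :=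
            mul_le_mul g2 (bη x) (abs_nonneg _) (by positivity)
        _ ≤ (m⁻¹ ^ 2 * K0 x (δ + m)⁻¹) * (100 * (r ^ 2 - x ^ 2) ^ 2) := by gcongr
        _ = _ := by rw [inv_pow]; ring
    calc _ ≤ h x (-m) * (100 / m ^ 2 * (K0 x (δ + m)⁻¹ * (r ^ 2 - x ^ 2) ^ 2)) := by gcongr
      _ = _ := by ring
  rw [intervalIntegral.integral_const_mul] at I2
  have e0 : ∫ x in (-r)..r, h x 0 * (K2 x (δ - 0)⁻¹ * (exp (0 * 0) * η x)) =
      ∫ x in (-r)..r, h x 0 * (K2 x δ⁻¹ * η x) := by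
    congr 1; ext x; simp
  rw [e0] at key
  have h5 := mul_le_mul_of_nonneg_left s1 (by positivity : 0 ≤ 100 / m ^ 2)
  have h6 : P * E * (0 - -m) ≤ P * E := by nlinarith [mul_nonneg hP0 hE0]
  linarith

lemma step4 {h : ℝ → ℝ → ℝ} (H : IsHeatSolution h)
    (hh : ∀ x ∈ Set.Icc (-1 : ℝ) 1, ∀ t ∈ Set.Icc (-1 : ℝ) 0, 0 ≤ h x t)
    {η η1 η2 : ℝ → ℝ} {B : ℝ} (hB : 0 < B)
    (dη : ∀ x, HasDerivAt η (η1 x) x) (dη1 : ∀ x, HasDerivAt η1 (η2 x) x) (cη2 : Continuous η2)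
    (bη : ∀ x, |η x| ≤ 1) (bη1 : ∀ x, |η1 x| ≤ B) (bη2 : ∀ x, |η2 x| ≤ B)
    (zi : ∀ x, |x| < 31 / 40 → η1 x = 0 ∧ η2 x = 0)
    (zo : ∀ x, 4 / 5 < |x| → η x = 0 ∧ η1 x = 0 ∧ η2 x = 0)
    {r M m : ℝ} (hr : 0 < r) (hr1 : r < 1) (hr2 : 3 / 4 ≤ r ^ 2)
    (hM : ∀ t ∈ Icc (-1 : ℝ) 0, h r t ≤ M ∧ h (-r) t ≤ M)
    (hm : 0 < m) (hm1 : m ≤ 1 / 2) :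
    √(π / (1 / 4)) * (deriv (deriv (fun y => h y 0)) 0 * η 0) ≤
      100 / m ^ 2 * exp 9 * (√(π / (1 / 4)) * (h 0 0 * r ^ 4)) +
      30 * B * (24 / (3 / 320) ^ 4) * exp (-(1 / (8 * m))) *
        (13 * (exp (19 / 2) * √(π / (1 / 4)) * h 0 0) + 3 * M) := by
  have hrr : -r ≤ r := by linarith
  have hr45 : 4 / 5 < r := by nlinarith
  have cη : Continuous η := continuous_iff_continuousAt.2 fun x => (dη x).continuousAt
  have cη1 : Continuous η1 := continuous_iff_continuousAt.2 fun x => (dη1 x).continuousAt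
  have zr := zo r (by rwa [abs_of_pos hr])
  have zr' := zo (-r) (by rwa [abs_neg, abs_of_pos hr])
  have hsub : Icc (-r) r ⊆ Ioo (-1) 1 := fun x hx => ⟨by linarith [hx.1], by linarith [hx.2]⟩
  obtain ⟨s1, s2, s3⟩ := slice_facts (heat_slice H (t := 0) ⟨by norm_num, le_rfl⟩)
  set f : ℝ → ℝ := fun y => h y 0 with hf
  have cf : ContinuousOn f (Icc (-r) r) := fun x hx => (s1 x (hsub hx)).continuousAt.continuousWithinAt
  have cf1 : ContinuousOn (deriv f) (Icc (-r) r) :=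
    fun x hx => (s2 x (hsub hx)).continuousAt.continuousWithinAt
  have cf2 : ContinuousOn (deriv (deriv f)) (Icc (-r) r) := s3.mono hsub
  set g : ℝ → ℝ := fun x => deriv (deriv f) x * η x + 2 * deriv f x * η1 x + f x * η2 x with hg
  have cg : ContinuousOn g (Icc (-r) r) := by
    rw [hg]; fun_prop
  have parts : ∀ δ : ℝ, ∫ x in (-r)..r, h x 0 * (K2 x δ⁻¹ * η x) = ∫ x in (-r)..r, g x * K0 x δ⁻¹ := by
    intro δ
    have c0 := K0_slice_c δ⁻¹
    have c2 : Continuous (fun x => K2 x δ⁻¹) :=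
      K2_c.comp (by fun_prop : Continuous fun x : ℝ => (x, δ⁻¹))
    have i1 : IntervalIntegrable (fun x => f x * (K2 x δ⁻¹ * η x)) MeasureTheory.volume (-r) r := by
      apply ContinuousOn.intervalIntegrable
      rw [uIcc_of_le hrr]; fun_prop
    have i2 : IntervalIntegrable (fun x => g x * K0 x δ⁻¹) MeasureTheory.volume (-r) r := by
      apply ContinuousOn.intervalIntegrable
      rw [uIcc_of_le hrr]; fun_prop
    have := intervalIntegral.integral_eq_sub_of_hasDerivAt (a := -r) (b := r)
      (f := fun x => f x * η x * K1 x δ⁻¹ - (deriv f x * η x + f x * η1 x) * K0 x δ⁻¹)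
      (f' := fun x => f x * (K2 x δ⁻¹ * η x) - g x * K0 x δ⁻¹) (by
        intro x hx
        rw [uIcc_of_le hrr] at hx
        have a1 := s1 x (hsub hx)
        have a2 := s2 x (hsub hx)
        refine (((a1.mul (dη x)).mul (K1_dx δ⁻¹ x)).sub
          (((a2.mul (dη x)).add (a1.mul (dη1 x))).mul (K0_dx δ⁻¹ x))).congr_deriv ?_
        simp only [hg, Pi.mul_apply, Pi.add_apply]
        ring) (i1.sub i2)
    rw [intervalIntegral.integral_sub i1 i2] at this
    simp only [zr.1, zr'.1, zr.2.1, zr'.2.1] at this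
    simp only [mul_zero, zero_mul, add_zero, sub_zero] at this
    linarith
  have hg0 : g 0 = deriv (deriv f) 0 * η 0 := by
    have := zi 0 (by norm_num)
    simp only [hg, this.1, this.2]; ring
  have L := delta_lim hr cg
  rw [hg0] at L
  have R := ((step1_lim H hr hr1).const_mul (100 / m ^ 2 * exp 9)).add_const
    (30 * B * (24 / (3 / 320) ^ 4) * exp (-(1 / (8 * m))) *
        (13 * (exp (19 / 2) * √(π / (1 / 4)) * h 0 0) + 3 * M))
  refine le_of_tendsto_of_tendsto L R ?_
  filter_upwards [Ioo_mem_nhdsGT (show (0 : ℝ) < m / 8 by linarith)] with δ hδ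
  rw [← parts δ]
  exact step3 H hh hB dη dη1 cη2 bη bη1 bη2 zi zo hr hr1 hr2 hM hm hm1 hδ.1 hδ.2

lemma near_bdry {h : ℝ → ℝ → ℝ} (H : IsHeatSolution h) {M ε : ℝ} (hε : 0 < ε)
    (hM : ∀ t ∈ Icc (-1 : ℝ) 0, h 1 t ≤ M ∧ h (-1) t ≤ M) :
    ∃ r : ℝ, 0 < r ∧ r < 1 ∧ 3 / 4 ≤ r ^ 2 ∧
      ∀ t ∈ Icc (-1 : ℝ) 0, h r t ≤ M + ε ∧ h (-r) t ≤ M + ε := by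
  have hu := (isCompact_Icc.prod isCompact_Icc).uniformContinuousOn_of_continuous H.1
  rw [Metric.uniformContinuousOn_iff] at hu
  obtain ⟨d, hd, hu⟩ := hu ε hε
  set e := min (d / 2) (1 / 10) with he
  have he0 : 0 < e := lt_min (by linarith) (by norm_num)
  have he1 : e ≤ 1 / 10 := min_le_right _ _
  have he2 : e < d := (min_le_left _ _).trans_lt (by linarith)
  refine ⟨1 - e, by linarith, by linarith, by nlinarith, fun t ht => ?_⟩
  have a1 := hu (1 - e, t) ⟨⟨by linarith, by linarith⟩, ht⟩ (1, t) ⟨⟨by norm_num, le_rfl⟩, ht⟩ (by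
    rw [Prod.dist_eq, dist_self, Real.dist_eq]
    simpa [abs_of_pos he0, hd] using he2)
  have a2 := hu (-(1 - e), t) ⟨⟨by linarith, by linarith⟩, ht⟩ (-1, t) ⟨⟨le_rfl, by norm_num⟩, ht⟩ (by
    rw [Prod.dist_eq, dist_self, Real.dist_eq]
    simpa [abs_of_pos he0, hd] using he2)
  rw [Real.dist_eq, abs_lt] at a1 a2
  simp only at a1 a2
  have := hM t ht
  exact ⟨by linarith, by linarith⟩

theorem heat_second_derivative_estimate :
    ∃ C > (0 : ℝ), ∀ h : ℝ → ℝ → ℝ, IsHeatSolution h →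
      (∀ x ∈ Set.Icc (-1 : ℝ) 1, ∀ t ∈ Set.Icc (-1 : ℝ) 0, 0 ≤ h x t) →
      ∀ μ ∈ Set.Ioo (0 : ℝ) 1,
        |deriv (deriv (fun y => h y 0)) 0| ≤
          C / μ ^ 2 * h 0 0 +
            C * Real.exp (-(1 / (8 * μ))) *
              sSup ((fun p : ℝ × ℝ => h p.1 p.2) ''
                (({-1, 1} : Set ℝ) ×ˢ Set.Icc (-1 : ℝ) 0)) := by
  obtain ⟨η, η1, η2, B, hB, dη, dη1, cη2, bη, bη1, bη2, zi, zo⟩ := bump_exists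
  set c0 : ℝ := √(π / (1 / 4)) with hc0
  have hc01 : 1 ≤ c0 := by
    rw [hc0, Real.one_le_sqrt]; have := Real.pi_gt_three; linarith
  set P : ℝ := 30 * B * (24 / (3 / 320) ^ 4) with hP
  have hP0 : 0 < P := by positivity
  refine ⟨400 * exp 9 * c0 + P * (13 * (exp (19 / 2) * c0)) + 3 * P, by positivity, ?_⟩
  intro h H hh μ hμ
  set M := sSup ((fun p : ℝ × ℝ => h p.1 p.2) '' (({-1, 1} : Set ℝ) ×ˢ Set.Icc (-1 : ℝ) 0)) with hMdef
  have hbdd : BddAbove ((fun p : ℝ × ℝ => h p.1 p.2) '' (({-1, 1} : Set ℝ) ×ˢ Set.Icc (-1 : ℝ) 0)) := by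
    refine IsCompact.bddAbove_image ((Set.toFinite _).isCompact.prod isCompact_Icc) (H.1.mono ?_)
    refine Set.prod_mono ?_ le_rfl
    rintro x (rfl | rfl) <;> constructor <;> norm_num
  have hM : ∀ t ∈ Icc (-1 : ℝ) 0, h 1 t ≤ M ∧ h (-1) t ≤ M := fun t ht =>
    ⟨le_csSup hbdd ⟨(1, t), ⟨by simp, ht⟩, rfl⟩, le_csSup hbdd ⟨(-1, t), ⟨by simp, ht⟩, rfl⟩⟩
  have h00 : 0 ≤ h 0 0 := hh 0 (by simp) 0 (by simp)
  have hM0 : 0 ≤ M := (hh 1 (by simp) 0 (by simp)).trans (hM 0 (by simp)).1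
  have hμ0 := hμ.1
  set m := min μ (1 / 2) with hm
  have hm0 : 0 < m := lt_min hμ0 (by norm_num)
  have hm1 : m ≤ 1 / 2 := min_le_right _ _
  have hmμ : m ≤ μ := min_le_left _ _
  have hmμ2 : μ / 2 ≤ m := le_min (by linarith) (by linarith [hμ.2])
  set D := deriv (deriv (fun y => h y 0)) 0 with hD
  set X := exp (-(1 / (8 * μ))) with hX
  have hXm : exp (-(1 / (8 * m))) ≤ X := by
    apply Real.exp_le_exp.2
    apply neg_le_neg
    gcongr
  have hX1 : X ≤ 1 := by
    rw [hX, Real.exp_le_one_iff]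
    have : 0 < 1 / (8 * μ) := by positivity
    linarith
  have hX0 : 0 < X := Real.exp_pos _
  refine le_of_forall_pos_le_add fun ε' hε' => ?_
  have hε : 0 < ε' / (3 * P) := by positivity
  set ε := ε' / (3 * P) with hεd
  have hεe : 3 * P * ε = ε' := by rw [hεd]; field_simp
  obtain ⟨r, hr, hr1, hr2, hMr⟩ := near_bdry H hε hM
  have up := step4 H hh hB dη dη1 cη2
    (fun x => by rw [abs_of_nonneg (bη x).1]; exact (bη x).2) bη1 bη2 (fun x hx => (zi x hx).2) zo
    hr hr1 hr2 hMr hm0 hm1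
  have dn := step4 H hh hB (η := fun x => - η x) (η1 := fun x => - η1 x) (η2 := fun x => - η2 x)
    (fun x => (dη x).neg) (fun x => (dη1 x).neg) cη2.neg
    (fun x => by rw [abs_neg, abs_of_nonneg (bη x).1]; exact (bη x).2)
    (fun x => by rw [abs_neg]; exact bη1 x) (fun x => by rw [abs_neg]; exact bη2 x)
    (fun x hx => by simp [(zi x hx).2]) (fun x hx => by simp [(zo x hx)])
    hr hr1 hr2 hMr hm0 hm1
  have hη0 := (zi 0 (by norm_num)).1
  simp only [hη0, mul_one, mul_neg] at up dn
  have hR : c0 * |D| ≤ 100 / m ^ 2 * exp 9 * (c0 * (h 0 0 * r ^ 4)) +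
      P * exp (-(1 / (8 * m))) * (13 * (exp (19 / 2) * c0 * h 0 0) + 3 * (M + ε)) := by
    rcases abs_cases D with ⟨h1, _⟩ | ⟨h1, _⟩
    · rw [h1]; exact up
    · rw [h1, mul_neg]; exact dn
  have hDc : |D| ≤ c0 * |D| := le_mul_of_one_le_left (abs_nonneg _) hc01
  have hr4 : r ^ 4 ≤ 1 := pow_le_one₀ hr.le hr1.le
  have hm4 : 100 / m ^ 2 ≤ 400 / μ ^ 2 := by
    rw [div_le_div_iff₀ (by positivity) (by positivity)]
    have : (μ / 2) ^ 2 ≤ m ^ 2 := by gcongr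
    linarith
  have T1 : 100 / m ^ 2 * exp 9 * (c0 * (h 0 0 * r ^ 4)) ≤ 400 / μ ^ 2 * exp 9 * (c0 * (h 0 0 * 1)) := by
    gcongr
  have hμ1 : 1 ≤ 1 / μ ^ 2 := by
    rw [le_div_iff₀ (by positivity), one_mul]; exact pow_le_one₀ hμ0.le hμ.2.le
  have T2 : P * exp (-(1 / (8 * m))) * (13 * (exp (19 / 2) * c0 * h 0 0) + 3 * (M + ε)) ≤
      P * (13 * (exp (19 / 2) * c0)) * (1 / μ ^ 2) * h 0 0 + 3 * P * X * M + ε' := by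
    calc _ ≤ P * X * (13 * (exp (19 / 2) * c0 * h 0 0) + 3 * (M + ε)) := by gcongr
      _ = P * (13 * (exp (19 / 2) * c0)) * X * h 0 0 + 3 * P * X * M + X * (3 * P * ε) := by ring
      _ ≤ P * (13 * (exp (19 / 2) * c0)) * (1 / μ ^ 2) * h 0 0 + 3 * P * X * M + 1 * (3 * P * ε) := by
        gcongr
        exact hX1.trans hμ1
      _ = _ := by rw [hεe, one_mul]
  have n1 : 0 ≤ 3 * P * (1 / μ ^ 2) * h 0 0 := by positivity
  have n2 : 0 ≤ (400 * exp 9 * c0 + P * (13 * (exp (19 / 2) * c0))) * X * M := by positivity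
  have fin : |D| ≤ 400 / μ ^ 2 * exp 9 * (c0 * (h 0 0 * 1)) +
      (P * (13 * (exp (19 / 2) * c0)) * (1 / μ ^ 2) * h 0 0 + 3 * P * X * M + ε') +
      3 * P * (1 / μ ^ 2) * h 0 0 +
      (400 * exp 9 * c0 + P * (13 * (exp (19 / 2) * c0))) * X * M := by linarith
  refine fin.trans (le_of_eq ?_)
  ring
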